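/- Let V be a finite-dimensional complex vector space with a nondegenerate symmetric bilinear form Q. Then the subspace of O(V)-invariants in (V*)^{⊗ n} is zero when n is odd, and when n = 2k it is spanned by the tensors obtained from the k-fold tensor product Q ⊗ ... ⊗ Q by permuting the 2k tensor factors. -/

import Mathlib

namespace OrthogonalInvariants

open Module Function

section

variable {V : Type*} [AddCommGroup V] [Module ℂ V] {Q : V →ₗ[ℂ] V →ₗ[ℂ] ℂ}
  {ι : Type*} {κ : Type*}

/-- Invariance of a multilinear form under all isometries of `Q`. -/
def IsInvariant (Q : V →ₗ[ℂ] V →ₗ[ℂ] ℂ) (T : MultilinearMap ℂ (fun _ : ι => V) ℂ) : Prop :=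
  ∀ g : V ≃ₗ[ℂ] V, (∀ x y : V, Q (g x) (g y) = Q x y) →
    ∀ v : ι → V, T (fun i => g (v i)) = T v

/-- The span of the products of `k` values of `Q` on pairwise distinct slots. -/
def pairings (Q : V →ₗ[ℂ] V →ₗ[ℂ] ℂ) (ι : Type*) (k : ℕ) : Submodule ℂ ((ι → V) → ℂ) :=
  Submodule.span ℂ {f | ∃ p q : Fin k → ι, Injective p ∧ Injective q ∧ (∀ s t, p s ≠ q t) ∧
    f = fun v => ∏ s, Q (v (p s)) (v (q s))}

/-- `e` is orthonormal for `Q`. -/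
def IsOrthonormal [DecidableEq κ] (Q : V →ₗ[ℂ] V →ₗ[ℂ] ℂ) (e : Basis κ ℂ V) : Prop :=
  ∀ a b, Q (e a) (e b) = if a = b then 1 else 0

theorem exists_orthonormal_basis [FiniteDimensional ℂ V] (hsymm : ∀ x y : V, Q x y = Q y x)
    (hnondeg : ∀ v : V, (∀ w : V, Q v w = 0) → v = 0) :
    ∃ e : Basis (Fin (finrank ℂ V)) ℂ V, IsOrthonormal Q e := by
  obtain ⟨b, hb⟩ := LinearMap.BilinForm.exists_orthogonal_basis (B := Q) ⟨hsymm⟩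
  have hb' : ∀ i j, i ≠ j → Q (b i) (b j) = 0 := fun i j hij => hb hij
  have hne : ∀ i, Q (b i) (b i) ≠ 0 := by
    intro i hi
    refine b.ne_zero i (hnondeg _ fun w => ?_)
    have : Q (b i) = 0 := b.ext fun j => by
      by_cases hij : i = j
      · subst hij; simpa using hi
      · simpa using hb' i j hij
    simp [this]
  choose c hc using fun i => IsAlgClosed.exists_pow_nat_eq (Q (b i) (b i)) (n := 2) (by norm_num)
  have hc0 : ∀ i, c i ≠ 0 := by
    intro i h
    apply hne i
    rw [← hc, h]; simp
  refine ⟨b.isUnitSMul (w := fun i => (c i)⁻¹) fun i => (inv_ne_zero (hc0 i)).isUnit, ?_⟩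
  intro i j
  rw [Basis.isUnitSMul_apply, Basis.isUnitSMul_apply]
  split_ifs with hij
  · subst hij
    have := hc0 i
    simp only [map_smul, LinearMap.smul_apply, smul_eq_mul, ← hc]
    field_simp
  · simp [hb' i j hij]

theorem IsOrthonormal.sum_smul [Fintype κ] [DecidableEq κ] {e : Basis κ ℂ V}
    (he : IsOrthonormal Q e) (x : V) : ∑ a, Q x (e a) • e a = x := by
  conv_rhs => rw [← e.sum_repr x]
  refine Finset.sum_congr rfl fun a _ => ?_
  congr 1
  have h : Q (∑ b, e.repr x b • e b) (e a) = e.repr x a := by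
    simp only [map_sum, map_smul, LinearMap.sum_apply, LinearMap.smul_apply, he _ a]
    simp
  rwa [e.sum_repr] at h

theorem IsInvariant.apply_linearMap [FiniteDimensional ℂ V]
    (hnondeg : ∀ v : V, (∀ w : V, Q v w = 0) → v = 0)
    {T : MultilinearMap ℂ (fun _ : ι => V) ℂ} (hT : IsInvariant Q T) (f : V →ₗ[ℂ] V)
    (hf : ∀ x y, Q (f x) (f y) = Q x y) (v : ι → V) : T (fun i => f (v i)) = T v := by
  have hinj : Injective f := by
    rw [← LinearMap.ker_eq_bot, LinearMap.ker_eq_bot']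
    intro x hx
    refine hnondeg x fun w => ?_
    rw [← hf, hx]; simp
  exact hT (LinearEquiv.ofInjectiveEndo f hinj) (by simpa using hf) v

variable [DecidableEq ι]

theorem continuous_apply_add_smul [Fintype ι] (T : MultilinearMap ℂ (fun _ : ι => V) ℂ)
    (x y : ι → V) :
    Continuous fun t : ℂ => T (x + t • y) := by
  have : (fun t : ℂ => T (x + t • y)) =
      fun t => ∑ s : Finset ι, t ^ s.card * T (s.piecewise y x) := by
    ext t
    rw [add_comm, T.map_add_univ]
    refine Finset.sum_congr rfl fun s _ => ?_
    have h := T.map_piecewise_smul (fun _ => t) (s.piecewise y x) s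
    rw [Finset.prod_const, smul_eq_mul] at h
    rw [← h]
    congr 1
    ext i
    by_cases hi : i ∈ s <;> simp [hi]
  rw [this]
  fun_prop

/-- If `T` is constant along the curve `x + s • (y - t • z)`, where `s = 2t / (1 + t ^ 2)`, then its
derivative at `x` in the direction `y` vanishes. -/
theorem sum_update_eq_zero_of_curve [Fintype ι] (T : MultilinearMap ℂ (fun _ : ι => V) ℂ)
    (x y z : ι → V)
    (h : ∀ s t : ℂ, s * (1 + t ^ 2) = 2 * t → T (x + s • (y - t • z)) = T x) :
    ∑ i, T (update x i (y i)) = 0 := by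
  let S : ℂ → ℂ := fun t => 2 * t / (1 + t ^ 2)
  let F : ℂ → ℂ := fun t => T.linearDeriv x y - t * T.linearDeriv x z +
    ∑ s : Finset ι with 2 ≤ s.card, S t ^ (s.card - 1) * T (s.piecewise (y - t • z) x)
  have hS : ContinuousAt S 0 := by
    apply ContinuousAt.div <;> first | fun_prop | simp
  have hF : ContinuousAt F 0 := by
    refine ContinuousAt.add (by fun_prop) (tendsto_finsetSum _ fun s _ => ?_)
    refine ContinuousAt.mul (hS.pow _) (Continuous.continuousAt ?_)
    have := continuous_apply_add_smul T (s.piecewise y x) (s.piecewise (-z) 0)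
    convert this using 3 with t
    ext i
    by_cases hi : i ∈ s <;> simp [hi, sub_eq_add_neg]
  have hF0 : F 0 = ∑ i, T (update x i (y i)) := by
    have : ∑ s : Finset ι with 2 ≤ s.card, S 0 ^ (s.card - 1) *
        T (s.piecewise (y - (0 : ℂ) • z) x) = 0 := by
      refine Finset.sum_eq_zero fun s hs => ?_
      have : 2 ≤ s.card := by simpa using hs
      simp [S, show s.card - 1 ≠ 0 by omega]
    simp only [F, this]
    simp
  have hev : ∀ᶠ t in nhdsWithin (0 : ℂ) {0}ᶜ, F t = 0 := by
    have h1 : ∀ᶠ t in nhdsWithin (0 : ℂ) {0}ᶜ, 1 + t ^ 2 ≠ 0 := by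
      refine Filter.Eventually.filter_mono nhdsWithin_le_nhds ?_
      have : ContinuousAt (fun t : ℂ => 1 + t ^ 2) 0 := by fun_prop
      exact this.eventually_ne (by simp)
    filter_upwards [h1, self_mem_nhdsWithin] with t ht ht0
    have ht0 : t ≠ 0 := ht0
    have hs : S t ≠ 0 := by simp [S, ht, ht0]
    have key := h (S t) t (by simp [S]; field_simp)
    rw [T.map_add_eq_map_add_linearDeriv_add, add_assoc, add_eq_left] at key
    refine (mul_eq_zero.mp (?_ : S t * F t = 0)).resolve_left hs
    rw [← key, map_smul, map_sub, map_smul, smul_eq_mul, smul_eq_mul, mul_add, Finset.mul_sum]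
    congr 1
    refine Finset.sum_congr rfl fun s hs => ?_
    have h2 : 2 ≤ s.card := by simpa using hs
    have h := T.map_piecewise_smul (fun _ => S t) (s.piecewise (y - t • z) x) s
    rw [Finset.prod_const, smul_eq_mul] at h
    rw [← mul_assoc, ← pow_succ', Nat.sub_add_cancel (by omega), ← h]
    congr 1
    ext i
    by_cases hi : i ∈ s <;> simp [hi]
  rw [← hF0]
  have hlim : Filter.Tendsto F (nhdsWithin (0 : ℂ) {0}ᶜ) (nhds (F 0)) :=
    hF.tendsto.mono_left nhdsWithin_le_nhds
  exact tendsto_nhds_unique (hlim.congr' hev) tendsto_const_nhds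

variable [Fintype ι] [Fintype κ] [DecidableEq κ]

omit [Fintype κ] in
/-- Invariance under the infinitesimal rotation in the plane spanned by `e a` and `w`. -/
theorem IsInvariant.sum_update_eq_zero [FiniteDimensional ℂ V] (hsymm : ∀ x y : V, Q x y = Q y x)
    (hnondeg : ∀ v : V, (∀ w : V, Q v w = 0) → v = 0)
    {e : Basis κ ℂ V} (he : IsOrthonormal Q e)
    {T : MultilinearMap ℂ (fun _ : ι => V) ℂ} (hT : IsInvariant Q T) (a : κ) (w : V) (v : ι → V) :
    ∑ i, T (update v i (Q (v i) (e a) • w - Q (v i) w • e a)) = 0 := by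
  let L : V →ₗ[ℂ] ℂ := ∑ i, (T.toLinearMap v i).comp
    (Q (v i) (e a) • LinearMap.id - (Q (v i)).smulRight (e a))
  suffices hL : L = 0 by simpa [L] using LinearMap.congr_fun hL w
  refine e.ext fun b => ?_
  suffices h : ∑ i, T (update v i (Q (v i) (e a) • e b - Q (v i) (e b) • e a)) = 0 by
    simpa [L] using h
  by_cases hab : a = b
  · subst hab
    exact Finset.sum_eq_zero fun i _ => by
      rw [sub_self]; exact T.map_update_zero v i
  refine sum_update_eq_zero_of_curve T v _
    (fun i => Q (v i) (e a) • e a + Q (v i) (e b) • e b) fun s t hst => ?_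
  let f : V →ₗ[ℂ] V := LinearMap.id + s • (((Q.flip (e a)).smulRight (e b) -
    (Q.flip (e b)).smulRight (e a)) - t • ((Q.flip (e a)).smulRight (e a) +
      (Q.flip (e b)).smulRight (e b)))
  have hf : ∀ x, f x = x + s • ((Q x (e a) • e b - Q x (e b) • e a) -
    t • (Q x (e a) • e a + Q x (e b) • e b)) := fun x => by simp [f]
  rw [← hT.apply_linearMap hnondeg f ?_ v]
  · congr 1
  · intro x y
    have h1 : Q (e a) (e a) = 1 := by simp [he a a]
    have h2 : Q (e b) (e b) = 1 := by simp [he b b]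
    have h3 : Q (e a) (e b) = 0 := by simp [he a b, hab]
    have h4 : Q (e b) (e a) = 0 := by simp [he b a, Ne.symm hab]
    simp only [hf, map_add, map_sub, map_smul, LinearMap.add_apply, LinearMap.sub_apply,
      LinearMap.smul_apply, smul_eq_mul, h1, h2, h3, h4, hsymm (e a) y, hsymm (e b) y]
    linear_combination (Q x (e a) * Q y (e a) + Q x (e b) * Q y (e b)) * s * hst

theorem sum_apply_eq_sum_apply {e e' : Basis κ ℂ V} (he : IsOrthonormal Q e)
    (he' : IsOrthonormal Q e') (hsymm : ∀ x y : V, Q x y = Q y x) (B : V →ₗ[ℂ] V →ₗ[ℂ] ℂ) :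
    ∑ a, B (e a) (e a) = ∑ a, B (e' a) (e' a) := by
  calc ∑ a, B (e a) (e a) = ∑ a, ∑ b, Q (e a) (e' b) * B (e' b) (e a) := by
        refine Finset.sum_congr rfl fun a _ => ?_
        conv_lhs => enter [1]; rw [← he'.sum_smul (e a)]
        simp
    _ = ∑ b, ∑ a, Q (e' b) (e a) * B (e' b) (e a) := by
        rw [Finset.sum_comm]
        simp only [hsymm (e' _) (e _)]
    _ = ∑ b, B (e' b) (e' b) := by
        refine Finset.sum_congr rfl fun b _ => ?_
        conv_rhs => enter [2]; rw [← he.sum_smul (e' b)]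
        simp


/-- The Casimir operator of the orthogonal Lie algebra, acting through one slot, expresses
the sum of transpositions by contractions. -/
theorem IsInvariant.casimir [FiniteDimensional ℂ V] (hsymm : ∀ x y : V, Q x y = Q y x)
    (hnondeg : ∀ v : V, (∀ w : V, Q v w = 0) → v = 0)
    {e : Basis κ ℂ V} (he : IsOrthonormal Q e)
    {T : MultilinearMap ℂ (fun _ : ι => V) ℂ} (hT : IsInvariant Q T) (i : ι) (v : ι → V) :
    ((Fintype.card κ : ℂ) - 1) * T v + ∑ j ∈ Finset.univ.erase i, T (v ∘ Equiv.swap i j) =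
      ∑ j ∈ Finset.univ.erase i,
        Q (v i) (v j) * ∑ a, T (update (update v i (e a)) j (e a)) := by
  have expand : ∀ (w : ι → V) (j : ι) (x : V),
      ∑ a, Q x (e a) * T (update w j (e a)) = T (update w j x) := fun w j x => by
    conv_rhs => rw [← he.sum_smul x]
    simp [T.map_update_sum]
  have key : ∀ a, T v - Q (v i) (e a) * T (update v i (e a)) +
      ∑ j ∈ Finset.univ.erase i, (Q (v j) (e a) * T (update (update v j (v i)) i (e a)) -
        Q (v i) (v j) * T (update (update v i (e a)) j (e a))) = 0 := fun a => by
    rw [← hT.sum_update_eq_zero hsymm hnondeg he a (v i) (update v i (e a)),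
      ← Finset.add_sum_erase _ _ (Finset.mem_univ i)]
    congr 1
    · simp [he a a, hsymm (e a) (v i), T.map_update_sub]
    · refine Finset.sum_congr rfl fun j hj => ?_
      have hji : j ≠ i := Finset.ne_of_mem_erase hj
      rw [T.map_update_sub, T.map_update_smul, T.map_update_smul, update_of_ne hji,
        update_comm hji.symm (e a) (v i) v, hsymm (v i)]
      rfl
  have hsum := Finset.sum_eq_zero fun a (_ : a ∈ (Finset.univ : Finset κ)) => key a
  rw [Finset.sum_add_distrib, Finset.sum_sub_distrib, expand, update_eq_self, Finset.sum_comm,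
    Finset.sum_congr rfl fun j _ => Finset.sum_sub_distrib _ _, Finset.sum_sub_distrib] at hsum
  have hswap : ∑ j ∈ Finset.univ.erase i, T (v ∘ Equiv.swap i j) = ∑ j ∈ Finset.univ.erase i,
      ∑ a, Q (v j) (e a) * T (update (update v j (v i)) i (e a)) := by
    refine Finset.sum_congr rfl fun j hj => ?_
    rw [expand, Equiv.comp_swap_eq_update]
  simp only [Finset.sum_const, Finset.card_univ, nsmul_eq_mul, ← hswap, ← Finset.mul_sum] at hsum
  linear_combination hsum

/-- The contraction of two slots of a multilinear form along a basis. -/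
noncomputable def contraction (e : Basis κ ℂ V) (T : MultilinearMap ℂ (fun _ : ι => V) ℂ)
    (i j : ι) : MultilinearMap ℂ (fun _ : {x // x ≠ i ∧ x ≠ j} => V) ℂ :=
  ∑ a, T.domDomRestrict (fun x => x ≠ i ∧ x ≠ j) fun _ => e a

omit [DecidableEq κ] [Fintype ι] in
theorem contraction_restrict (e : Basis κ ℂ V) (T : MultilinearMap ℂ (fun _ : ι => V) ℂ)
    (i j : ι) (v : ι → V) :
    contraction e T i j (fun x => v x) = ∑ a, T (update (update v i (e a)) j (e a)) := by
  rw [contraction, sum_apply]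
  refine Finset.sum_congr rfl fun a _ => ?_
  rw [MultilinearMap.domDomRestrict_apply]
  congr 1
  ext x
  by_cases hj : x = j
  · subst hj; simp
  · by_cases hi : x = i
    · subst hi; simp [hj]
    · simp [hi, hj]

omit [Fintype ι] in
theorem isInvariant_contraction (hsymm : ∀ x y : V, Q x y = Q y x)
    {e : Basis κ ℂ V} (he : IsOrthonormal Q e)
    {T : MultilinearMap ℂ (fun _ : ι => V) ℂ} (hT : IsInvariant Q T) {i j : ι} (hij : i ≠ j) :
    IsInvariant Q (contraction e T i j) := by
  intro g hg v
  let w : ι → V := fun x => if h : x ≠ i ∧ x ≠ j then v ⟨x, h⟩ else 0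
  let B : V →ₗ[ℂ] V →ₗ[ℂ] ℂ := LinearMap.mk₂ ℂ
    (fun x y => T (update (update (fun k => g (w k)) i x) j y))
    (fun x x' y => by simp only [update_comm hij, T.map_update_add])
    (fun c x y => by simp only [update_comm hij, T.map_update_smul])
    (fun x y y' => T.map_update_add _ _ _ _) (fun c x y => T.map_update_smul _ _ _ _)
  have hw : ∀ x : {x // x ≠ i ∧ x ≠ j}, w x = v x := fun x => by simp [w, x.2]
  have he' : IsOrthonormal Q (e.map g) := fun a b => by simpa [hg] using he a b
  calc contraction e T i j (fun x => g (v x)) = ∑ a, B (e a) (e a) := by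
        simp only [← hw]
        exact contraction_restrict e T i j (fun k => g (w k))
    _ = ∑ a, B (e.map g a) (e.map g a) := sum_apply_eq_sum_apply he he' hsymm B
    _ = ∑ a, T (update (update w i (e a)) j (e a)) := by
        refine Finset.sum_congr rfl fun a _ => ?_
        rw [← hT g hg (update (update w i (e a)) j (e a))]
        simp only [B, LinearMap.mk₂_apply, Basis.map_apply]
        congr 1
        ext x
        by_cases hj : x = j
        · subst hj; simp
        · by_cases hi : x = i
          · subst hi; simp [hj]
          · simp [hi, hj]
    _ = contraction e T i j v := by
        rw [← contraction_restrict]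
        simp only [hw]

omit [DecidableEq ι] [Fintype ι] in
theorem mul_mem_pairings {i j : ι} (hij : i ≠ j) {k : ℕ}
    {f : ({x // x ≠ i ∧ x ≠ j} → V) → ℂ} (hf : f ∈ pairings Q {x // x ≠ i ∧ x ≠ j} k) :
    (fun v : ι → V => Q (v i) (v j) * f (fun x => v x)) ∈ pairings Q ι (k + 1) := by
  induction hf using Submodule.span_induction with
  | mem f hf =>
    obtain ⟨p, q, hp, hq, hpq, rfl⟩ := hf
    refine Submodule.subset_span ⟨Fin.cons i fun s => (p s).1, Fin.cons j fun s => (q s).1,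
      ?_, ?_, ?_, ?_⟩
    · rw [Fin.cons_injective_iff]
      refine ⟨?_, Subtype.val_injective.comp hp⟩
      rintro ⟨s, hs⟩
      exact (p s).2.1 hs
    · rw [Fin.cons_injective_iff]
      refine ⟨?_, Subtype.val_injective.comp hq⟩
      rintro ⟨s, hs⟩
      exact (q s).2.2 hs
    · intro s t
      refine Fin.cases ?_ (fun s => ?_) s <;> refine Fin.cases ?_ (fun t => ?_) t
      · simpa using hij
      · simpa using (q t).2.1.symm
      · simpa using (p s).2.2
      · simpa [Subtype.ext_iff] using hpq s t
    · ext v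
      simp [Fin.prod_univ_succ]
  | zero =>
    convert (pairings Q ι (k + 1)).zero_mem using 1
    ext v
    simp
  | add f g _ _ hf hg =>
    convert add_mem hf hg using 1
    ext v
    simp [mul_add]
  | smul c f _ hf =>
    convert Submodule.smul_mem _ c hf using 1
    ext v
    simp only [Pi.smul_apply, smul_eq_mul]
    ring

/-- `T` changes sign under the transposition of two slots in `S`. -/
def AntisymmetricOn (T : MultilinearMap ℂ (fun _ : ι => V) ℂ) (S : Finset ι) : Prop :=
  ∀ i ∈ S, ∀ j ∈ S, i ≠ j → ∀ v : ι → V, T (v ∘ Equiv.swap i j) = -T v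

omit [Fintype ι] in
theorem AntisymmetricOn.apply_eq_zero {T : MultilinearMap ℂ (fun _ : ι => V) ℂ} {S : Finset ι}
    (hT : AntisymmetricOn T S) {v : ι → V} {i j : ι} (hi : i ∈ S) (hj : j ∈ S) (hij : i ≠ j)
    (hv : v i = v j) : T v = 0 := by
  have h := hT i hi j hj hij v
  rw [Equiv.comp_swap_eq_update, hv, update_eq_self, ← hv, update_eq_self] at h
  exact self_eq_neg.mp h

omit [DecidableEq κ] in
theorem AntisymmetricOn.eq_zero (e : Basis κ ℂ V) {T : MultilinearMap ℂ (fun _ : ι => V) ℂ}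
    {S : Finset ι} (hT : AntisymmetricOn T S) (hS : Fintype.card κ < S.card) : T = 0 := by
  refine Basis.ext_multilinear (fun _ => e) fun f => ?_
  obtain ⟨i, hi, j, hj, hij, h⟩ := Finset.exists_ne_map_eq_of_card_lt_of_maps_to
    (t := Finset.univ) (by simpa using hS) (f := f) (fun _ _ => by simp)
  exact hT.apply_eq_zero hi hj hij (by rw [h])

omit [Fintype κ] in
theorem IsInvariant.eq_zero_of_antisymmetricOn_univ [FiniteDimensional ℂ V]
    (hsymm : ∀ x y : V, Q x y = Q y x)
    (hnondeg : ∀ v : V, (∀ w : V, Q v w = 0) → v = 0)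
    {e : Basis κ ℂ V} (he : IsOrthonormal Q e)
    {T : MultilinearMap ℂ (fun _ : ι => V) ℂ} (hT : IsInvariant Q T) [Nonempty ι]
    (hanti : AntisymmetricOn T Finset.univ) : T = 0 := by
  refine Basis.ext_multilinear (fun _ => e) fun f => ?_
  change T (fun k => e (f k)) = 0
  by_cases hf : Function.Injective f
  · obtain ⟨i⟩ := ‹Nonempty ι›
    let r : V →ₗ[ℂ] V := LinearMap.id - (2 : ℂ) • (Q.flip (e (f i))).smulRight (e (f i))
    have hr : ∀ x, r x = x - (2 : ℂ) • Q x (e (f i)) • e (f i) := fun x => by simp [r]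
    have h := hT.apply_linearMap hnondeg r (fun x y => by
      have h1 : Q (e (f i)) (e (f i)) = 1 := by simp [he (f i) (f i)]
      simp only [hr, map_sub, map_smul, LinearMap.sub_apply, LinearMap.smul_apply, smul_eq_mul,
        h1, hsymm (e (f i)) y]
      ring) (fun k => e (f k))
    have hupd : (fun k => r (e (f k))) =
        update (fun k => e (f k)) i ((-1 : ℂ) • e (f i)) := by
      ext k
      by_cases hk : k = i
      · subst hk
        simp only [hr, he (f k) (f k), update_self, if_true]
        module
      · simp [hr, he (f k) (f i), hf.ne hk, hk]
    rw [hupd, T.map_update_smul, update_eq_self, smul_eq_mul, neg_one_mul] at h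
    exact self_eq_neg.mp h.symm
  · simp only [Function.Injective, not_forall] at hf
    obtain ⟨i, j, h, hij⟩ := hf
    exact hanti.apply_eq_zero (Finset.mem_univ i) (Finset.mem_univ j) hij (by rw [h])

omit [Fintype ι] in
theorem AntisymmetricOn.sub_sum_swap {T : MultilinearMap ℂ (fun _ : ι => V) ℂ} {S : Finset ι}
    (hT : AntisymmetricOn T S) {j : ι} (hj : j ∉ S) :
    AntisymmetricOn (T - ∑ i ∈ S, T.domDomCongr (Equiv.swap i j)) (insert j S) := by
  have happ : ∀ v, (T - ∑ i ∈ S, T.domDomCongr (Equiv.swap i j)) v =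
      T v - ∑ i ∈ S, T (v ∘ Equiv.swap i j) := fun v => by
    simp [Function.comp_def]
  have hmix : ∀ a ∈ S, ∀ v, (T - ∑ i ∈ S, T.domDomCongr (Equiv.swap i j)) (v ∘ Equiv.swap a j) =
      -(T - ∑ i ∈ S, T.domDomCongr (Equiv.swap i j)) v := by
    intro a ha v
    have haj : a ≠ j := fun h => hj (h ▸ ha)
    rw [happ, happ, ← Finset.add_sum_erase _ _ ha, ← Finset.add_sum_erase S
      (fun i => T (v ∘ Equiv.swap i j)) ha]
    have hrest : ∑ i ∈ S.erase a, T ((v ∘ Equiv.swap a j) ∘ Equiv.swap i j) =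
        -∑ i ∈ S.erase a, T (v ∘ Equiv.swap i j) := by
      rw [← Finset.sum_neg_distrib]
      refine Finset.sum_congr rfl fun i hi => ?_
      obtain ⟨hia, hi⟩ := Finset.mem_erase.mp hi
      have hij : i ≠ j := fun h => hj (h ▸ hi)
      rw [← hT i hi a ha hia]
      congr 1
      ext x
      simp only [comp_apply]
      congr 1
      simp only [Equiv.swap_apply_def]
      grind
    have hself : (v ∘ Equiv.swap a j) ∘ Equiv.swap a j = v := by
      ext x; simp
    rw [hrest, hself]
    ring
  intro a ha b hb hab v
  rcases Finset.mem_insert.mp ha with haj | ha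
  · subst haj
    rcases Finset.mem_insert.mp hb with hba | hb
    · exact absurd hba.symm hab
    · rw [Equiv.swap_comm]
      exact hmix b hb v
  · rcases Finset.mem_insert.mp hb with hbj | hb
    · rw [hbj]
      exact hmix a ha v
    · rw [happ, happ, hT a ha b hb hab]
      have : ∑ i ∈ S, T ((v ∘ Equiv.swap a b) ∘ Equiv.swap i j) =
          ∑ i ∈ S, -T (v ∘ Equiv.swap (Equiv.swap a b i) j) := by
        refine Finset.sum_congr rfl fun i hi => ?_
        rw [← hT a ha b hb hab]
        have haj : a ≠ j := fun h => hj (h ▸ ha)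
        have hbj : b ≠ j := fun h => hj (h ▸ hb)
        have h := Equiv.mul_swap_eq_swap_mul (Equiv.swap a b) i j
        rw [Equiv.swap_apply_of_ne_of_ne haj.symm hbj.symm] at h
        congr 1
        ext x
        exact congrArg v (Equiv.congr_fun h x)
      rw [this, Equiv.Perm.sum_comp (Equiv.swap a b) S (fun i => -T (v ∘ Equiv.swap i j))]
      · rw [Finset.sum_neg_distrib]
        ring
      · intro x hx
        by_contra hxS
        exact hx (Equiv.swap_apply_of_ne_of_ne (fun h => hxS (h ▸ ha)) (fun h => hxS (h ▸ hb)))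

omit [DecidableEq ι] [Fintype ι] in
theorem IsInvariant.domDomCongr {T : MultilinearMap ℂ (fun _ : ι => V) ℂ} (hT : IsInvariant Q T)
    (σ : Equiv.Perm ι) : IsInvariant Q (T.domDomCongr σ) :=
  fun g hg v => hT g hg fun i => v (σ i)

/-- An invariant form that is antisymmetric on a nonempty set of slots lies in any subspace that
contains the right hand sides of `IsInvariant.casimir`. -/
theorem IsInvariant.mem_of_antisymmetricOn [FiniteDimensional ℂ V]
    (hsymm : ∀ x y : V, Q x y = Q y x)
    (hnondeg : ∀ v : V, (∀ w : V, Q v w = 0) → v = 0)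
    {e : Basis κ ℂ V} (he : IsOrthonormal Q e) (P : Submodule ℂ ((ι → V) → ℂ))
    (hP : ∀ T : MultilinearMap ℂ (fun _ : ι => V) ℂ, IsInvariant Q T → ∀ i,
      (fun v => ((Fintype.card κ : ℂ) - 1) * T v +
        ∑ j ∈ Finset.univ.erase i, T (v ∘ Equiv.swap i j)) ∈ P)
    (r : ℕ) : ∀ (S : Finset ι), S.Nonempty → Fintype.card κ + 1 ≤ S.card + r →
      ∀ T : MultilinearMap ℂ (fun _ : ι => V) ℂ, IsInvariant Q T → AntisymmetricOn T S →
        (T : (ι → V) → ℂ) ∈ P := by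
  induction r with
  | zero =>
    intro S _ hc T _ hanti
    rw [hanti.eq_zero e (by omega)]
    exact P.zero_mem
  | succ r ih =>
    intro S hS hc T hT hanti
    by_cases hlt : Fintype.card κ < S.card
    · rw [hanti.eq_zero e hlt]
      exact P.zero_mem
    have hSn : S.card ≤ Fintype.card ι := S.card_le_univ
    have hSpos : 0 < S.card := hS.card_pos
    by_cases htop : S.card = Fintype.card κ ∧ S.card = Fintype.card ι
    · have : S = Finset.univ := Finset.card_eq_iff_eq_univ S |>.mp htop.2
      subst this
      have : Nonempty ι := hS.to_type
      rw [hT.eq_zero_of_antisymmetricOn_univ hsymm hnondeg he hanti]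
      exact P.zero_mem
    have hf : ∀ i ∈ S, (fun v => ((Fintype.card κ : ℂ) - S.card) * T v +
        ∑ j ∈ Sᶜ, T (v ∘ Equiv.swap i j)) ∈ P := by
      intro i hi
      convert hP T hT i using 1
      ext v
      have hsub : Sᶜ ⊆ Finset.univ.erase i := by
        intro j hj
        simp only [Finset.mem_compl] at hj
        simpa using fun h : j = i => hj (h ▸ hi)
      have hsd : Finset.univ.erase i \ Sᶜ = S.erase i := by
        ext x; simp
      rw [← Finset.sum_sdiff hsub, hsd, Finset.sum_congr rfl fun j hj =>
        hanti i hi j (Finset.mem_of_mem_erase hj) (Finset.ne_of_mem_erase hj).symm v]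
      rw [Finset.sum_const, Finset.card_erase_of_mem hi, nsmul_eq_mul, Nat.cast_pred hSpos]
      ring
    have hg : ∀ j ∈ Sᶜ, (fun v => T v - ∑ i ∈ S, T (v ∘ Equiv.swap i j)) ∈ P := by
      intro j hj
      have hj : j ∉ S := by simpa using hj
      have := ih (insert j S) (Finset.insert_nonempty _ _)
        (by rw [Finset.card_insert_of_notMem hj]; omega) _ ?_ (hanti.sub_sum_swap hj)
      · convert this using 1
        ext v
        simp [Function.comp_def]
      · intro g hg v
        simp only [sub_apply, sum_apply, hT g hg v,
          (hT.domDomCongr _) g hg v]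
    have hsum := P.add_mem (P.sum_mem hf) (P.sum_mem hg)
    let c : ℕ := S.card * (Fintype.card κ - S.card) + (Fintype.card ι - S.card)
    have hc0 : (c : ℂ) ≠ 0 := by
      rw [Nat.cast_ne_zero]
      intro h0
      obtain ⟨h1, h2⟩ := Nat.add_eq_zero_iff.mp h0
      rcases Nat.mul_eq_zero.mp h1 with h1 | h1 <;> omega
    convert P.smul_mem (c : ℂ)⁻¹ hsum using 1
    ext v
    simp only [Pi.smul_apply, Pi.add_apply, Finset.sum_apply, smul_eq_mul,
      Finset.sum_add_distrib, Finset.sum_sub_distrib, Finset.sum_const, nsmul_eq_mul]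
    rw [Finset.sum_comm (s := S), Finset.card_compl, eq_inv_mul_iff_mul_eq₀ hc0]
    simp only [c]
    push_cast [Nat.cast_sub hSn, Nat.cast_sub (not_lt.mp hlt)]
    ring

end

theorem IsInvariant.mem_pairings {V : Type*} [AddCommGroup V] [Module ℂ V]
    [FiniteDimensional ℂ V] {Q : V →ₗ[ℂ] V →ₗ[ℂ] ℂ} (hsymm : ∀ x y : V, Q x y = Q y x)
    (hnondeg : ∀ v : V, (∀ w : V, Q v w = 0) → v = 0) (k : ℕ) :
    ∀ {ι : Type*} [Fintype ι] [DecidableEq ι], Fintype.card ι = 2 * k →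
      ∀ T : MultilinearMap ℂ (fun _ : ι => V) ℂ, IsInvariant Q T →
        (T : (ι → V) → ℂ) ∈ pairings Q ι k := by
  obtain ⟨e, he⟩ := exists_orthonormal_basis hsymm hnondeg
  induction k with
  | zero =>
    intro ι _ _ hcard T _
    have : IsEmpty ι := Fintype.card_eq_zero_iff.mp (by simpa using hcard)
    have h1 : (fun _ : ι → V => (1 : ℂ)) ∈ pairings Q ι 0 :=
      Submodule.subset_span ⟨Fin.elim0, Fin.elim0, fun s => s.elim0, fun s => s.elim0,
        fun s => s.elim0, by simp⟩
    convert Submodule.smul_mem _ (T isEmptyElim) h1 using 1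
    ext v
    simp [Subsingleton.elim v isEmptyElim]
  | succ k ih =>
    intro ι _ _ hcard T hT
    have : Nonempty ι := Fintype.card_pos_iff.mp (by omega)
    obtain ⟨i₀⟩ := ‹Nonempty ι›
    refine hT.mem_of_antisymmetricOn hsymm hnondeg he _ (fun T hT i => ?_) (finrank ℂ V)
      {i₀} (Finset.singleton_nonempty _) (by simp [add_comm]) T ?_
    · have h := Submodule.sum_mem (pairings Q ι (k + 1)) (t := Finset.univ.erase i)
        (f := fun j v => Q (v i) (v j) * contraction e T i j fun x => v x) fun j hj => by
          have hij : i ≠ j := (Finset.ne_of_mem_erase hj).symm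
          refine mul_mem_pairings hij (ih ?_ _ (isInvariant_contraction hsymm he hT hij))
          have : (Finset.univ.filter fun x => x ≠ i ∧ x ≠ j) =
              (Finset.univ.erase i).erase j := by
            ext x; simp [and_comm]
          rw [Fintype.card_subtype, this, Finset.card_erase_of_mem (by simpa using hij.symm),
            Finset.card_erase_of_mem (Finset.mem_univ _), Finset.card_univ, hcard]
          omega
      convert h using 1
      ext v
      rw [hT.casimir hsymm hnondeg he i v]
      simp only [Finset.sum_apply, contraction_restrict]
    · intro i hi j hj hij
      rw [Finset.mem_singleton] at hi hj
      exact absurd (hi.trans hj.symm) hij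

end OrthogonalInvariants


/-- first fundamental theorem of invariant theory for O(V):
invariants of (V*)^{⊗n} vanish for n odd, and for n = 2k every invariant is a
linear combination of permuted k-fold products of the form Q. -/
theorem orthogonal_invariants
    (V : Type*) [AddCommGroup V] [Module ℂ V] [FiniteDimensional ℂ V]
    (Q : V →ₗ[ℂ] V →ₗ[ℂ] ℂ)
    (hsymm : ∀ x y : V, Q x y = Q y x)
    (hnondeg : ∀ v : V, (∀ w : V, Q v w = 0) → v = 0) :
    (∀ (n : ℕ), Odd n → ∀ T : MultilinearMap ℂ (fun _ : Fin n => V) ℂ,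
      (∀ g : V ≃ₗ[ℂ] V, (∀ x y : V, Q (g x) (g y) = Q x y) →
        ∀ v : Fin n → V, T (fun i => g (v i)) = T v) → T = 0)
    ∧
    (∀ (k : ℕ) (T : MultilinearMap ℂ (fun _ : Fin (2 * k) => V) ℂ),
      (∀ g : V ≃ₗ[ℂ] V, (∀ x y : V, Q (g x) (g y) = Q x y) →
        ∀ v : Fin (2 * k) → V, T (fun i => g (v i)) = T v) →
      ∃ c : Equiv.Perm (Fin (2 * k)) → ℂ, ∀ v : Fin (2 * k) → V,
        T v = ∑ σ : Equiv.Perm (Fin (2 * k)), c σ *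
          ∏ i : Fin k,
            Q (v (σ ⟨2 * i.1, by have := i.2; omega⟩))
              (v (σ ⟨2 * i.1 + 1, by have := i.2; omega⟩)))
    ∧
    (∀ (k : ℕ) (σ : Equiv.Perm (Fin (2 * k))) (g : V ≃ₗ[ℂ] V),
      (∀ x y : V, Q (g x) (g y) = Q x y) → ∀ v : Fin (2 * k) → V,
        (∏ i : Fin k,
            Q (g (v (σ ⟨2 * i.1, by have := i.2; omega⟩)))
              (g (v (σ ⟨2 * i.1 + 1, by have := i.2; omega⟩))))
          = ∏ i : Fin k,
              Q (v (σ ⟨2 * i.1, by have := i.2; omega⟩))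
                (v (σ ⟨2 * i.1 + 1, by have := i.2; omega⟩))) := by
  classical
  refine ⟨fun n hn T hT => ?_, fun k T hT => ?_, fun k σ g hg v => by simp only [hg]⟩
  · ext v
    have h := hT (LinearEquiv.neg ℂ) (by simp) v
    have h2 := T.map_smul_univ (fun _ => (-1 : ℂ)) v
    simp only [Finset.prod_const, Finset.card_univ, Fintype.card_fin, hn.neg_one_pow,
      neg_smul, one_smul] at h2
    simp only [LinearEquiv.neg_apply] at h
    exact self_eq_neg.mp (h.symm.trans h2)
  · have hmem := OrthogonalInvariants.IsInvariant.mem_pairings hsymm hnondeg k (by simp) T hT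
    let f : Equiv.Perm (Fin (2 * k)) → ((Fin (2 * k) → V) → ℂ) := fun σ v => ∏ i : Fin k,
      Q (v (σ ⟨2 * i.1, by have := i.2; omega⟩)) (v (σ ⟨2 * i.1 + 1, by have := i.2; omega⟩))
    have hle : OrthogonalInvariants.pairings Q (Fin (2 * k)) k ≤
        Submodule.span ℂ (Set.range f) := by
      refine Submodule.span_mono ?_
      rintro _ ⟨p, q, hp, hq, hpq, rfl⟩
      let τ : Fin (2 * k) → Fin (2 * k) := fun x =>
        if x.1 % 2 = 0 then p ⟨x.1 / 2, by omega⟩ else q ⟨x.1 / 2, by omega⟩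
      have hτ : Function.Injective τ := by
        intro x y hxy
        simp only [τ] at hxy
        split_ifs at hxy with hx hy hy
        · have := Fin.mk.inj_iff.mp (hp hxy)
          omega
        · exact absurd hxy (hpq _ _)
        · exact absurd hxy.symm (hpq _ _)
        · have := Fin.mk.inj_iff.mp (hq hxy)
          omega
      refine ⟨Equiv.ofBijective τ (Finite.injective_iff_bijective.mp hτ), ?_⟩
      ext v
      refine Finset.prod_congr rfl fun i _ => ?_
      have h : (2 * i.1 + 1) / 2 = i.1 := by omega
      simp [τ, h, Nat.add_mod]
    obtain ⟨c, hc⟩ := (Submodule.mem_span_range_iff_exists_fun ℂ).mp (hle hmem)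
    refine ⟨c, fun v => ?_⟩
    rw [← hc]
    simp [f]
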